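/- For every ordered pair (Γ₀, Γ₁) of finite groups, there exists a finite simple graph G and a vertex v of G such that Aut(G) is isomorphic to Γ₀ and Aut(G − v) is isomorphic to Γ₁. -/

import Mathlib

def frR1 {X : Type} {m : ℕ} (π : ℕ → Equiv.Perm X) (p q : X × Fin m) : Prop :=
  (q.2.val = p.2.val + 1 ∧ q.1 = p.1) ∨ (q.2.val = p.2.val + 2 ∧ q.1 = π p.2.val p.1)

def frR {X : Type} {m : ℕ} (π : ℕ → Equiv.Perm X) (p q : X × Fin m) : Prop :=
  frR1 π p q ∨ frR1 π q p

def frG {X : Type} (m : ℕ) (π : ℕ → Equiv.Perm X) : SimpleGraph (X × Fin m) where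
  Adj p q := p ≠ q ∧ Xor (m ≤ p.2.val + q.2.val + 1) (frR π p q)
  symm := ⟨by
    rintro p q ⟨h1, h2⟩
    refine ⟨h1.symm, ?_⟩
    have e1 : frR π q p ↔ frR π p q := by unfold frR; exact or_comm
    rw [e1, add_comm q.2.val]; exact h2⟩
  loopless := ⟨fun p h => h.1 rfl⟩

theorem frR_ncard {X : Type} [Finite X] {m : ℕ} (π : ℕ → Equiv.Perm X) (p : X × Fin m) :
    {q | frR π p q}.ncard ≤ 4 := by
  have key : ∀ s : Set (X × Fin m), s.Subsingleton → s.ncard ≤ 1 := fun s hs =>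
    (Set.ncard_le_one_iff_subsingleton ).2 hs
  let s1 : Set (X × Fin m) := {q | q.2.val = p.2.val + 1 ∧ q.1 = p.1}
  let s2 : Set (X × Fin m) := {q | q.2.val = p.2.val + 2 ∧ q.1 = π p.2.val p.1}
  let s3 : Set (X × Fin m) := {q | p.2.val = q.2.val + 1 ∧ p.1 = q.1}
  let s4 : Set (X × Fin m) := {q | p.2.val = q.2.val + 2 ∧ p.1 = π q.2.val q.1}
  have h1 : s1.ncard ≤ 1 := key _ fun a ha b hb =>
    Prod.ext (ha.2.trans hb.2.symm) (Fin.ext (ha.1.trans hb.1.symm))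
  have h2 : s2.ncard ≤ 1 := key _ fun a ha b hb =>
    Prod.ext (ha.2.trans hb.2.symm) (Fin.ext (ha.1.trans hb.1.symm))
  have h3 : s3.ncard ≤ 1 := key _ fun a ha b hb =>
    Prod.ext (ha.2.symm.trans hb.2) (Fin.ext (by have := ha.1; have := hb.1; omega))
  have h4 : s4.ncard ≤ 1 := key _ fun a ha b hb => by
    have e : a.2.val = b.2.val := by have := ha.1; have := hb.1; omega
    have := ha.2.symm.trans hb.2
    rw [e] at this
    exact Prod.ext ((π b.2.val).injective this) (Fin.ext e)
  have hsub : {q | frR π p q} ⊆ (s1 ∪ s2) ∪ (s3 ∪ s4) := by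
    rintro q ((h | h) | (h | h))
    · exact Or.inl (Or.inl h)
    · exact Or.inl (Or.inr h)
    · exact Or.inr (Or.inl h)
    · exact Or.inr (Or.inr h)
  have := Set.ncard_le_ncard hsub (Set.toFinite _)
  have := Set.ncard_union_le (s1 ∪ s2) (s3 ∪ s4)
  have := Set.ncard_union_le s1 s2
  have := Set.ncard_union_le s3 s4
  omega

theorem frT_ncard {X : Type} [Finite X] {m : ℕ} (p : X × Fin m) :
    {q : X × Fin m | m ≤ p.2.val + q.2.val + 1}.ncard = Nat.card X * (p.2.val + 1) := by
  have e : {q : X × Fin m | m ≤ p.2.val + q.2.val + 1} =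
      (Set.univ : Set X) ×ˢ (Fin.rev '' (Set.Iic p.2)) := by
    ext q
    simp only [Set.mem_ofPred_eq, Set.mem_prod, Set.mem_univ, true_and, Set.mem_image, Set.mem_Iic]
    constructor
    · intro h
      refine ⟨q.2.rev, ?_, Fin.rev_rev _⟩
      rw [Fin.le_def, Fin.val_rev]; omega
    · rintro ⟨j, hj, hq⟩
      rw [← hq, Fin.val_rev]
      rw [Fin.le_def] at hj; omega
  rw [e, Set.ncard_prod, Set.ncard_univ, Set.ncard_image_of_injective _ Fin.rev_injective,
    ← Finset.coe_Iic, Set.ncard_coe_finset, Fin.card_Iic]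

theorem fr_deg {X : Type} [Finite X] {m : ℕ} (π : ℕ → Equiv.Perm X) (p : X × Fin m) :
    Nat.card X * (p.2.val + 1) ≤ ((frG m π).neighborSet p).ncard + 5 ∧
    ((frG m π).neighborSet p).ncard ≤ Nat.card X * (p.2.val + 1) + 4 := by
  have hT := frT_ncard p
  have hR := frR_ncard π p
  set T := {q : X × Fin m | m ≤ p.2.val + q.2.val + 1} with hTd
  set R := {q | frR π p q} with hRd
  have s1 : (frG m π).neighborSet p ⊆ T ∪ R := by
    rintro q ⟨_, h⟩
    rcases h with h | h
    · exact Or.inl h.1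
    · exact Or.inr h.1
  have s2 : T ⊆ ((frG m π).neighborSet p ∪ {p}) ∪ R := by
    intro q hq
    by_cases hr : frR π p q
    · exact Or.inr hr
    by_cases hp : q = p
    · exact Or.inl (Or.inr hp)
    · exact Or.inl (Or.inl ⟨fun h => hp h.symm, Or.inl ⟨hq, hr⟩⟩)
  have := Set.ncard_le_ncard s1 (Set.toFinite _)
  have := Set.ncard_le_ncard s2 (Set.toFinite _)
  have := Set.ncard_union_le T R
  have := Set.ncard_union_le ((frG m π).neighborSet p ∪ {p}) R
  have := Set.ncard_union_le ((frG m π).neighborSet p) {p}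
  have := Set.ncard_singleton p
  omega

theorem iso_ncard {V : Type} {G : SimpleGraph V} (φ : G ≃g G) (p : V) :
    (G.neighborSet (φ p)).ncard = (G.neighborSet p).ncard := by
  have : G.neighborSet (φ p) = φ '' G.neighborSet p := by
    ext q
    constructor
    · intro h
      refine ⟨φ.symm q, ?_, by simp⟩
      have h' : G.Adj (φ p) q := h
      have : G.Adj (φ p) (φ (φ.symm q)) := by simpa using h'
      exact φ.map_adj_iff.1 this
    · rintro ⟨r, hr, rfl⟩
      exact φ.map_adj_iff.2 hr
  rw [this, Set.ncard_image_of_injective _ φ.injective]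

theorem fr_level {X : Type} [Finite X] {m : ℕ} (π : ℕ → Equiv.Perm X) (hX : 10 ≤ Nat.card X)
    (φ : frG m π ≃g frG m π) (p : X × Fin m) : (φ p).2 = p.2 := by
  have h1 := fr_deg π p
  have h2 := fr_deg π (φ p)
  rw [iso_ncard] at h2
  apply Fin.ext
  generalize ((frG m π).neighborSet p).ncard = d at *
  generalize Nat.card X = N at *
  rcases lt_trichotomy (φ p).2.val p.2.val with h | h | h
  · have : N * ((φ p).2.val + 1 + 1) ≤ N * (p.2.val + 1) := Nat.mul_le_mul_left _ (by omega)
    rw [mul_add N ((φ p).2.val + 1)] at this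
    omega
  · exact h
  · have : N * (p.2.val + 1 + 1) ≤ N * ((φ p).2.val + 1) := Nat.mul_le_mul_left _ (by omega)
    rw [mul_add N (p.2.val + 1)] at this
    omega

theorem fr_R_iff {X : Type} [Finite X] {m : ℕ} (π : ℕ → Equiv.Perm X) (hX : 10 ≤ Nat.card X)
    (φ : frG m π ≃g frG m π) (p q : X × Fin m) (hpq : p ≠ q) (h : frR π p q) :
    frR π (φ p) (φ q) := by
  have e : (frG m π).Adj (φ p) (φ q) ↔ (frG m π).Adj p q := φ.map_adj_iff
  have hpq' : φ p ≠ φ q := fun h => hpq (φ.injective h)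
  have e' : (φ p ≠ φ q ∧ Xor (m ≤ (φ p).2.val + (φ q).2.val + 1) (frR π (φ p) (φ q))) ↔
      (p ≠ q ∧ Xor (m ≤ p.2.val + q.2.val + 1) (frR π p q)) := e
  rw [fr_level π hX φ p, fr_level π hX φ q] at e'
  unfold Xor at e'
  by_contra hn
  by_cases hm : m ≤ p.2.val + q.2.val + 1 <;> simp [hpq, hpq', h, hn, hm] at e'

theorem fr_comm {X : Type} [Finite X] {m : ℕ} (π : ℕ → Equiv.Perm X) (hX : 10 ≤ Nat.card X)
    (hm : 0 < m) (φ : frG m π ≃g frG m π) : ∃ f : X → X,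
    (∀ x i, φ (x, i) = (f x, i)) ∧ ∀ i, i + 2 < m → ∀ x, f (π i x) = π i (f x) := by
  have h1 : ∀ x (i : ℕ) (hi : i < m), φ (x, ⟨i, hi⟩) = ((φ (x, ⟨0, hm⟩)).1, ⟨i, hi⟩) := by
    intro x i
    induction i with
    | zero => intro hi; exact Prod.ext rfl (fr_level π hX φ _)
    | succ i ih =>
      intro hi
      have h := fr_R_iff π hX φ (x, ⟨i, by omega⟩) (x, ⟨i + 1, hi⟩) (by simp)
        (Or.inl (Or.inl ⟨rfl, rfl⟩))
      rw [ih] at h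
      have hl := fr_level π hX φ (x, ⟨i + 1, hi⟩)
      refine Prod.ext ?_ hl
      simp only [frR, frR1, hl] at h
      rcases h with (h | h) | (h | h)
      · exact h.2
      all_goals (have := h.1; omega)
  refine ⟨fun x => (φ (x, ⟨0, hm⟩)).1, fun x i => h1 x i.1 i.2, fun i hi x => ?_⟩
  have h := fr_R_iff π hX φ (x, ⟨i, by omega⟩) (π i x, ⟨i + 2, hi⟩) (by simp)
        (Or.inl (Or.inr ⟨rfl, rfl⟩))
  rw [h1 x, h1 (π i x)] at h
  simp only [frR, frR1] at h
  rcases h with (h | h) | (h | h)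
  · have := h.1; omega
  · exact h.2
  all_goals (have := h.1; omega)

def frLift {X : Type} (m : ℕ) (π : ℕ → Equiv.Perm X) (f : Equiv.Perm X)
    (hf : ∀ i x, f (π i x) = π i (f x)) : frG m π ≃g frG m π where
  toEquiv := f.prodCongr (Equiv.refl _)
  map_rel_iff' := by
    rintro ⟨x, i⟩ ⟨y, j⟩
    have : ∀ (x y : X) (i j : Fin m), frR1 π (f x, i) (f y, j) ↔ frR1 π (x, i) (y, j) := by
      intro x y i j
      simp [frR1, ← hf]
    simp [frG, frR, this]

theorem frucht (Γ : Type) [Group Γ] [Finite Γ] : ∃ (V : Type) (_ : Finite V) (H : SimpleGraph V)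
    (x : V), Nonempty ((H ≃g H) ≃* Γ) ∧ (∀ φ : H ≃g H, φ x = x → φ = 1) ∧
    ∀ v, 3 ≤ (H.neighborSet v).ncard := by
  classical
  let C := Γ × Equiv.Perm (Fin 10)
  obtain ⟨M, ⟨e⟩⟩ := Finite.exists_equiv_fin C
  let X := Γ × Fin 10
  let act : C → Equiv.Perm X := fun c => (Equiv.mulRight c.1).prodCongr c.2
  let π : ℕ → Equiv.Perm X := fun k => if h : k < M then act (e.symm ⟨k, h⟩) else 1
  have hX : 10 ≤ Nat.card X := by
    have : 0 < Nat.card Γ := Nat.card_pos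
    simp only [X, Nat.card_prod, Nat.card_fin]; omega
  let H := frG (M + 2) π
  have hπ : ∀ (g : Γ) i (x : X), (Equiv.mulLeft g).prodCongr (Equiv.refl (Fin 10)) (π i x) =
      π i ((Equiv.mulLeft g).prodCongr (Equiv.refl (Fin 10)) x) := by
    intro g i x
    by_cases h : i < M
    · have e : π i = act (e.symm ⟨i, h⟩) := dif_pos h
      rw [e]
      exact Prod.ext (mul_assoc _ _ _).symm rfl
    · simp [π, h]
  let F : Γ →* (H ≃g H) :=
    { toFun := fun g => frLift _ π ((Equiv.mulLeft g).prodCongr (Equiv.refl (Fin 10))) (hπ g)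
      map_one' := by
        ext1 p
        exact Prod.ext (Prod.ext (one_mul p.1.1) rfl) rfl
      map_mul' := by
        intro a b
        ext1 p
        exact Prod.ext (Prod.ext (mul_assoc a b p.1.1) rfl) rfl }
  have hF : ∀ g h s i, F g ((h, s), i) = ((g * h, s), i) := fun g h s i => rfl
  have surj : Function.Surjective F := by
    intro φ
    obtain ⟨f, hf, hc⟩ := fr_comm π hX (by omega) φ
    have hc' : ∀ (c : Γ) (τ : Equiv.Perm (Fin 10)) (g : Γ) (s : Fin 10),
        f (g * c, τ s) = ((f (g, s)).1 * c, τ (f (g, s)).2) := by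
      intro c τ g s
      have := hc (e (c, τ)).1 (by have := (e (c, τ)).2; omega) (g, s)
      have e1 : π (e (c, τ)).1 = act (c, τ) := by
        simp only [π, Fin.is_lt, dif_pos, Fin.eta, Equiv.symm_apply_apply]
      rw [e1] at this
      exact this
    have h0 : (f (1, 0)).2 = 0 := by
      by_contra h
      obtain ⟨t, ht0, ht⟩ : ∃ t : Fin 10, t ≠ 0 ∧ t ≠ (f (1, 0)).2 := by
        generalize (f (1, 0)).2 = u
        revert u; decide
      have := hc' 1 (Equiv.swap t (f (1, 0)).2) 1 0
      rw [Equiv.swap_apply_of_ne_of_ne ht0.symm (Ne.symm h)] at this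
      have := congrArg Prod.snd this
      simp at this
      exact ht this.symm
    refine ⟨(f (1, 0)).1, ?_⟩
    ext1 p
    obtain ⟨⟨g, s⟩, i⟩ := p
    rw [hF, hf]
    have := hc' g (Equiv.swap 0 s) 1 0
    rw [h0] at this
    simp at this
    rw [this]
  have inj : Function.Injective F := by
    intro a b h
    have := congrArg (fun φ : H ≃g H => (φ ((1, 0), 0)).1.1) h
    simpa [hF] using this
  refine ⟨X × Fin (M + 2), inferInstance, H, ((1, 0), 0),
    ⟨(MulEquiv.ofBijective F ⟨inj, surj⟩).symm⟩, ?_, ?_⟩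
  · intro φ h
    obtain ⟨g, rfl⟩ := surj φ
    rw [hF] at h
    have : g = 1 := by simpa using h
    rw [this, map_one]
  · intro v
    have := (fr_deg π v).1
    have h3 : Nat.card X * 1 ≤ Nat.card X * (v.2.val + 1) := Nat.mul_le_mul_left _ (by omega)
    have : 3 + 5 ≤ ((frG (M+2) π).neighborSet v).ncard + 5 := by omega
    exact Nat.le_of_add_le_add_right this

inductive VdW (A B L : Type) : Type
  | base : A → VdW A B L
  | fib : A → B → VdW A B L
  | leaf : L → VdW A B L

namespace VdW

variable {A B L : Type}

theorem finite' [Finite A] [Finite B] [Finite L] : Finite (VdW A B L) := by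
  let f : VdW A B L → A ⊕ (A × B) ⊕ L := fun w => match w with
    | base a => Sum.inl a
    | fib a b => Sum.inr (Sum.inl (a, b))
    | leaf l => Sum.inr (Sum.inr l)
  refine Finite.of_injective f ?_
  rintro (a | ⟨a, b⟩ | l) (a' | ⟨a', b'⟩ | l') h <;> simp_all [f]

def adj (H₀ : SimpleGraph A) (H₁ : SimpleGraph B) (x : B) (ι : L → A) :
    VdW A B L → VdW A B L → Prop
  | base a, base a' => H₀.Adj a a'
  | base a, fib a' _ => a = a'
  | fib a _, base a' => a' = a
  | fib a b, fib a' b' => a = a' ∧ H₁.Adj b b'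
  | fib a b, leaf l => a = ι l ∧ b = x
  | leaf l, fib a b => a = ι l ∧ b = x
  | _, _ => False

def graph (H₀ : SimpleGraph A) (H₁ : SimpleGraph B) (x : B) (ι : L → A) :
    SimpleGraph (VdW A B L) where
  Adj := adj H₀ H₁ x ι
  symm := ⟨by
    rintro (a | ⟨a, b⟩ | l) (a' | ⟨a', b'⟩ | l') h <;> simp_all [adj, SimpleGraph.adj_comm]⟩
  loopless := ⟨by rintro (a | ⟨a, b⟩ | l) h <;> simp_all [adj]⟩

variable {H₀ : SimpleGraph A} {H₁ : SimpleGraph B} {x : B} {ι : L → A}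

theorem deg_base [Finite A] [Finite B] [Finite L] (h3 : ∀ a, 3 ≤ (H₀.neighborSet a).ncard) (a : A) :
    Nat.card B + 3 ≤ ((graph H₀ H₁ x ι).neighborSet (base a)).ncard := by
  have := finite' (A := A) (B := B) (L := L)
  have hs : (fib a '' Set.univ) ∪ (base '' H₀.neighborSet a) ⊆
      (graph H₀ H₁ x ι).neighborSet (base a) := by
    rintro _ (⟨b, _, rfl⟩ | ⟨a', h, rfl⟩)
    · exact rfl
    · exact h
  have hd : Disjoint ((fib a '' Set.univ : Set (VdW A B L))) (base '' H₀.neighborSet a) := by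
    rw [Set.disjoint_left]
    rintro _ ⟨b, _, rfl⟩ ⟨a', _, h⟩
    cases h
  have h1 := Set.ncard_le_ncard hs (Set.toFinite _)
  rw [Set.ncard_union_eq hd (Set.toFinite _) (Set.toFinite _),
    Set.ncard_image_of_injective _ (fun b b' h => by cases h; rfl),
    Set.ncard_image_of_injective _ (fun b b' h => by cases h; rfl), Set.ncard_univ] at h1
  have := h3 a
  omega

theorem deg_fib [Finite A] [Finite B] [Finite L] (hι : Function.Injective ι) (a : A) (b : B) :
    ((graph H₀ H₁ x ι).neighborSet (fib a b)).ncard < Nat.card B + 3 := by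
  have := finite' (A := A) (B := B) (L := L)
  have hs : (graph H₀ H₁ x ι).neighborSet (fib a b) ⊆
      ((fib a '' Set.univ) ∪ {base a}) ∪ (leaf '' (ι ⁻¹' {a})) := by
    rintro (a' | ⟨a', b'⟩ | l) h
    · have h : a' = a := h
      exact Or.inl (Or.inr (by rw [h]; rfl))
    · have h : a = a' ∧ H₁.Adj b b' := h
      exact Or.inl (Or.inl ⟨b', trivial, by rw [h.1]⟩)
    · have h : a = ι l ∧ b = x := h
      exact Or.inr ⟨l, h.1.symm, rfl⟩
  have h1 := Set.ncard_le_ncard hs (Set.toFinite _)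
  have h2 := Set.ncard_union_le ((fib a '' Set.univ) ∪ {base a}) (leaf '' (ι ⁻¹' {a}) : Set (VdW A B L))
  have h3 := Set.ncard_union_le (fib a '' Set.univ) {(base a : VdW A B L)}
  have h4 : (fib a '' Set.univ : Set (VdW A B L)).ncard = Nat.card B := by
    rw [Set.ncard_image_of_injective _ (fun b b' h => by cases h; rfl), Set.ncard_univ]
  have h5 := Set.ncard_singleton (base a : VdW A B L)
  have h6 : (leaf '' (ι ⁻¹' {a}) : Set (VdW A B L)).ncard ≤ 1 := by
    refine Set.ncard_le_one_iff_subsingleton.2 ?_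
    rintro _ ⟨l, hl, rfl⟩ _ ⟨l', hl', rfl⟩
    have hl : ι l = a := hl
    have hl' : ι l' = a := hl'
    rw [hι (hl.trans hl'.symm)]
  omega

theorem deg_leaf [Finite A] [Finite B] [Finite L] (l : L) :
    ((graph H₀ H₁ x ι).neighborSet (leaf l)).ncard < Nat.card B + 3 := by
  have := finite' (A := A) (B := B) (L := L)
  have hs : (graph H₀ H₁ x ι).neighborSet (leaf l) ⊆ {fib (ι l) x} := by
    rintro (a' | ⟨a', b'⟩ | l) h
    · exact h.elim
    · have h : a' = ι l ∧ b' = x := h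
      rw [h.1, h.2]; rfl
    · exact h.elim
  have h1 := Set.ncard_le_ncard hs (Set.toFinite _)
  rw [Set.ncard_singleton] at h1
  omega

section
variable [Finite A] [Finite B] [Finite L] (h3 : ∀ a, 3 ≤ (H₀.neighborSet a).ncard)
  (hι : Function.Injective ι)

theorem map_base (h3 : ∀ a, 3 ≤ (H₀.neighborSet a).ncard)
    (hι : Function.Injective ι) (φ : graph H₀ H₁ x ι ≃g graph H₀ H₁ x ι) (a : A) :
    ∃ a', φ (base a) = base a' := by
  have h := deg_base (H₁ := H₁) (x := x) (ι := ι) h3 a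
  rw [← iso_ncard φ] at h
  rcases hp : φ (base a) with (a' | ⟨a', b⟩ | l)
  · exact ⟨a', rfl⟩
  · rw [hp] at h; exact absurd h (not_le.2 (deg_fib hι a' b))
  · rw [hp] at h; exact absurd h (not_le.2 (deg_leaf l))

theorem map_fib (h3 : ∀ a, 3 ≤ (H₀.neighborSet a).ncard)
    (hι : Function.Injective ι) (φ : graph H₀ H₁ x ι ≃g graph H₀ H₁ x ι) (a : A) (b : B) :
    ∃ a' b', φ (base a) = base a' ∧ φ (fib a b) = fib a' b' := by
  obtain ⟨a', ha⟩ := map_base h3 hι φ a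
  have hadj : (graph H₀ H₁ x ι).Adj (φ (base a)) (φ (fib a b)) := φ.map_adj_iff.2 rfl
  rw [ha] at hadj
  rcases hp : φ (fib a b) with (a₂ | ⟨a₂, b₂⟩ | l)
  · obtain ⟨a₃, h⟩ := map_base h3 hι φ.symm a₂
    rw [← hp] at h
    simp at h
  · rw [hp] at hadj
    have hadj : a' = a₂ := hadj
    exact ⟨a', b₂, ha, by rw [hadj]⟩
  · rw [hp] at hadj
    exact hadj.elim

theorem map_leaf (h3 : ∀ a, 3 ≤ (H₀.neighborSet a).ncard)
    (hι : Function.Injective ι) (φ : graph H₀ H₁ x ι ≃g graph H₀ H₁ x ι) (l : L) :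
    ∃ l', φ (leaf l) = leaf l' := by
  rcases hp : φ (leaf l) with (a₂ | ⟨a₂, b₂⟩ | l')
  · obtain ⟨a₃, h⟩ := map_base h3 hι φ.symm a₂
    rw [← hp] at h
    simp at h
  · obtain ⟨a₃, b₃, _, h⟩ := map_fib h3 hι φ.symm a₂ b₂
    rw [← hp] at h
    simp at h
  · exact ⟨l', rfl⟩

theorem struct (h3 : ∀ a, 3 ≤ (H₀.neighborSet a).ncard)
    (hι : Function.Injective ι) (φ : graph H₀ H₁ x ι ≃g graph H₀ H₁ x ι) :
    ∃ (σ : H₀ ≃g H₀) (τ : A → (H₁ ≃g H₁)) (κ : L → L), (∀ a, φ (base a) = base (σ a)) ∧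
      (∀ a b, φ (fib a b) = fib (σ a) (τ a b)) ∧ (∀ l, φ (leaf l) = leaf (κ l)) ∧
      (∀ l, ι (κ l) = σ (ι l)) ∧ (∀ l, τ (ι l) x = x) ∧ Function.Surjective κ := by
  have key : ∀ ψ : graph H₀ H₁ x ι ≃g graph H₀ H₁ x ι, ∃ (σ : A → A) (τ : A → B → B) (κ : L → L),
      (∀ a, ψ (base a) = base (σ a)) ∧ (∀ a b, ψ (fib a b) = fib (σ a) (τ a b)) ∧
      (∀ l, ψ (leaf l) = leaf (κ l)) := by
    intro ψ
    choose σ hσ using map_base h3 hι ψ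
    choose κ hκ using map_leaf h3 hι ψ
    have : ∀ a b, ∃ b', ψ (fib a b) = fib (σ a) b' := by
      intro a b
      obtain ⟨a', b', h, h'⟩ := map_fib h3 hι ψ a b
      rw [hσ] at h
      cases h
      exact ⟨b', h'⟩
    choose τ hτ using this
    exact ⟨σ, τ, κ, hσ, hτ, hκ⟩
  obtain ⟨σ, τ, κ, hσ, hτ, hκ⟩ := key φ
  obtain ⟨σ', τ', κ', hσ', hτ', hκ'⟩ := key φ.symm
  have s1 : ∀ a, σ' (σ a) = a := fun a => by
    have := φ.symm_apply_apply (base a)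
    rw [hσ, hσ'] at this
    exact base.inj this
  have s2 : ∀ a, σ (σ' a) = a := fun a => by
    have := φ.apply_symm_apply (base a)
    rw [hσ', hσ] at this
    exact base.inj this
  have t1 : ∀ a b, τ' (σ a) (τ a b) = b := fun a b => by
    have := φ.symm_apply_apply (fib a b)
    rw [hτ, hτ'] at this
    exact (fib.inj this).2
  have t2 : ∀ a b, τ a (τ' (σ a) b) = b := fun a b => by
    have := φ.apply_symm_apply (fib (σ a) b)
    rw [hτ', hτ] at this
    have := (fib.inj this).2
    rwa [s1] at this
  have k2 : ∀ a, κ (κ' a) = a := fun a => by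
    have := φ.apply_symm_apply (leaf a)
    rw [hκ', hκ] at this
    exact leaf.inj this
  have kk : ∀ l, σ (ι l) = ι (κ l) ∧ τ (ι l) x = x := by
    intro l
    have hadj : (graph H₀ H₁ x ι).Adj (φ (fib (ι l) x)) (φ (leaf l)) :=
      φ.map_adj_iff.2 ⟨rfl, rfl⟩
    rw [hτ, hκ] at hadj
    exact hadj
  refine ⟨⟨⟨σ, σ', s1, s2⟩, ?_⟩, fun a => ⟨⟨τ a, τ' (σ a), t1 a, t2 a⟩, ?_⟩, κ, hσ, hτ, hκ,
    fun l => (kk l).1.symm, fun l => (kk l).2, fun l => ⟨_, k2 l⟩⟩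
  · intro a a'
    have h : (graph H₀ H₁ x ι).Adj (φ (base a)) (φ (base a')) ↔
      (graph H₀ H₁ x ι).Adj (base a) (base a') := φ.map_adj_iff
    rw [hσ, hσ] at h
    exact h
  · intro b b'
    have h : (graph H₀ H₁ x ι).Adj (φ (fib a b)) (φ (fib a b')) ↔
      (graph H₀ H₁ x ι).Adj (fib a b) (fib a b') := φ.map_adj_iff
    rw [hτ, hτ] at h
    have h : (σ a = σ a ∧ H₁.Adj (τ a b) (τ a b')) ↔ (a = a ∧ H₁.Adj b b') := h
    simpa using h

end

def mapEq (σ : A ≃ A) (τ : A → (B ≃ B)) (κ : L ≃ L) : VdW A B L ≃ VdW A B L where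
  toFun
    | base a => base (σ a)
    | fib a b => fib (σ a) (τ a b)
    | leaf l => leaf (κ l)
  invFun
    | base a => base (σ.symm a)
    | fib a b => fib (σ.symm a) ((τ (σ.symm a)).symm b)
    | leaf l => leaf (κ.symm l)
  left_inv := by rintro (a | ⟨a, b⟩ | l) <;> simp
  right_inv := by rintro (a | ⟨a, b⟩ | l) <;> simp

def mk (σ : H₀ ≃g H₀) (τ : A → (H₁ ≃g H₁)) (κ : L ≃ L) (h : ∀ l, ι (κ l) = σ (ι l))
    (hx : ∀ l, τ (ι l) x = x) : graph H₀ H₁ x ι ≃g graph H₀ H₁ x ι where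
  toEquiv := mapEq σ.toEquiv (fun a => (τ a).toEquiv) κ
  map_rel_iff' := by
    have hl : ∀ a b l, (σ a = ι (κ l) ∧ τ a b = x) ↔ (a = ι l ∧ b = x) := by
      intro a b l
      rw [h, σ.injective.eq_iff]
      refine and_congr_right fun e => ?_
      constructor
      · intro hb
        apply (τ a).injective
        rw [hb, e, hx]
      · rintro rfl
        rw [e, hx]
    rintro (a | ⟨a, b⟩ | l) (a' | ⟨a', b'⟩ | l')
    · exact σ.map_adj_iff
    · exact σ.injective.eq_iff
    · exact Iff.rfl
    · exact σ.injective.eq_iff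
    · change (σ a = σ a' ∧ H₁.Adj (τ a b) (τ a' b')) ↔ (a = a' ∧ H₁.Adj b b')
      rw [σ.injective.eq_iff]
      refine and_congr_right fun e => ?_
      subst e
      exact (τ a).map_adj_iff
    · exact hl a b l'
    · exact Iff.rfl
    · exact hl a' b' l
    · exact Iff.rfl

theorem aut0 [Finite A] [Finite B] (H₀ : SimpleGraph A) (H₁ : SimpleGraph B) (x : B)
    (h3 : ∀ a, 3 ≤ (H₀.neighborSet a).ncard) (hx : ∀ φ : H₁ ≃g H₁, φ x = x → φ = 1) :
    Nonempty ((graph H₀ H₁ x (id : A → A) ≃g graph H₀ H₁ x (id : A → A)) ≃* (H₀ ≃g H₀)) := by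
  let F : (H₀ ≃g H₀) →* (graph H₀ H₁ x (id : A → A) ≃g graph H₀ H₁ x (id : A → A)) :=
    { toFun := fun σ => mk σ (fun _ => 1) σ.toEquiv (fun _ => rfl) (fun _ => rfl)
      map_one' := by
        ext1 p
        rcases p with (a | ⟨a, b⟩ | l) <;> rfl
      map_mul' := by
        intro σ σ'
        ext1 p
        rcases p with (a | ⟨a, b⟩ | l) <;> rfl }
  refine ⟨(MulEquiv.ofBijective F ⟨?_, ?_⟩).symm⟩
  · intro σ σ' h
    ext1 a
    have := congrArg (fun φ => φ (base a)) h
    exact base.inj this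
  · intro φ
    obtain ⟨σ, τ, κ, hσ, hτ, hκ, h1, h2, _⟩ := struct h3 Function.injective_id φ
    refine ⟨σ, ?_⟩
    ext1 p
    rcases p with (a | ⟨a, b⟩ | l)
    · rw [hσ]; rfl
    · rw [hτ, hx (τ a) (h2 a)]; rfl
    · rw [hκ]; exact congrArg leaf (h1 l).symm

theorem aut1 [Finite A] [Finite B] (H₀ : SimpleGraph A) (H₁ : SimpleGraph B) (x : B) (y : A)
    (h3 : ∀ a, 3 ≤ (H₀.neighborSet a).ncard) (hx : ∀ φ : H₁ ≃g H₁, φ x = x → φ = 1)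
    (hy : ∀ φ : H₀ ≃g H₀, φ y = y → φ = 1) :
    Nonempty ((graph H₀ H₁ x (Subtype.val : {a // a ≠ y} → A) ≃g
      graph H₀ H₁ x (Subtype.val : {a // a ≠ y} → A)) ≃* (H₁ ≃g H₁)) := by
  classical
  let F : (H₁ ≃g H₁) →* (graph H₀ H₁ x (Subtype.val : {a // a ≠ y} → A) ≃g
      graph H₀ H₁ x (Subtype.val : {a // a ≠ y} → A)) :=
    { toFun := fun ρ => mk 1 (fun a => if a = y then ρ else 1) (Equiv.refl _) (fun _ => rfl)
        (fun l => by rw [if_neg l.2]; rfl)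
      map_one' := by
        ext1 p
        rcases p with (a | ⟨a, b⟩ | l)
        · rfl
        · change fib a ((if a = y then (1 : H₁ ≃g H₁) else 1) b) = fib a b
          rw [ite_self]; rfl
        · rfl
      map_mul' := by
        intro ρ ρ'
        ext1 p
        rcases p with (a | ⟨a, b⟩ | l)
        · rfl
        · change fib a ((if a = y then ρ * ρ' else 1) b) =
            fib a ((if a = y then ρ else 1) ((if a = y then ρ' else 1) b))
          split_ifs <;> rfl
        · rfl }
  have hF : ∀ ρ a b, F ρ (fib a b) = fib a ((if a = y then ρ else 1) b) := fun _ _ _ => rfl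
  refine ⟨(MulEquiv.ofBijective F ⟨?_, ?_⟩).symm⟩
  · intro σ σ' h
    ext1 b
    have := congrArg (fun φ => φ (fib y b)) h
    simp only [hF, if_true] at this
    exact (fib.inj this).2
  · intro φ
    obtain ⟨σ, τ, κ, hσ, hτ, hκ, h1, h2, hs⟩ := struct h3 Subtype.val_injective φ
    have e : σ = 1 := by
      apply hy
      by_contra hne
      obtain ⟨l, hl⟩ := hs ⟨σ y, hne⟩
      have := h1 l
      rw [hl] at this
      exact l.2 (σ.injective this).symm
    subst e
    refine ⟨τ y, ?_⟩
    ext1 p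
    rcases p with (a | ⟨a, b⟩ | l)
    · rw [hσ]; rfl
    · rw [hτ, hF]
      by_cases h : a = y
      · subst h; rw [if_pos rfl]; rfl
      · rw [if_neg h, hx _ (h2 ⟨a, h⟩)]; rfl
    · rw [hκ]; exact congrArg leaf (Subtype.ext (h1 l).symm)

def delIso (H₀ : SimpleGraph A) (H₁ : SimpleGraph B) (x : B) (y : A) :
    graph H₀ H₁ x (Subtype.val : {a // a ≠ y} → A) ≃g
      (graph H₀ H₁ x (id : A → A)).induce ({leaf y}ᶜ : Set (VdW A B A)) where
  toFun
    | base a => ⟨base a, fun h => by cases h⟩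
    | fib a b => ⟨fib a b, fun h => by cases h⟩
    | leaf l => ⟨leaf l.1, fun h => l.2 (leaf.inj h)⟩
  invFun
    | ⟨base a, _⟩ => base a
    | ⟨fib a b, _⟩ => fib a b
    | ⟨leaf l, h⟩ => leaf ⟨l, fun e => h (congrArg leaf e)⟩
  left_inv := by rintro (a | ⟨a, b⟩ | l) <;> rfl
  right_inv := by rintro ⟨(a | ⟨a, b⟩ | l), h⟩ <;> rfl
  map_rel_iff' := by rintro (a | ⟨a, b⟩ | l) (a' | ⟨a', b'⟩ | l') <;> exact Iff.rfl

end VdW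

def autConj {V W : Type} {G : SimpleGraph V} {H : SimpleGraph W} (e : G ≃g H) :
    (H ≃g H) ≃* (G ≃g G) where
  toFun φ := (e.trans φ).trans e.symm
  invFun φ := (e.symm.trans φ).trans e
  left_inv φ := by ext1 p; simp
  right_inv φ := by ext1 p; simp
  map_mul' φ ψ := by ext1 p; simp


/-- **Hartke–Kolb–Nishikawa–Stolee.** For every ordered pair `(Γ₀, Γ₁)` of finite
groups, there is a finite simple graph `G` and a vertex `v` of `G` such that
`Aut(G) ≅ Γ₀` and `Aut(G - v) ≅ Γ₁`. -/
theorem vertex_deleted_pair (Γ₀ Γ₁ : Type) [Group Γ₀] [Finite Γ₀] [Group Γ₁] [Finite Γ₁] :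
    ∃ (V : Type) (_ : Fintype V) (G : SimpleGraph V) (v : V),
      Nonempty ((G ≃g G) ≃* Γ₀) ∧
      Nonempty ((G.induce ({v}ᶜ : Set V) ≃g G.induce ({v}ᶜ : Set V)) ≃* Γ₁) := by
  obtain ⟨A, _, H₀, y, ⟨e₀⟩, hy, h3⟩ := frucht Γ₀
  obtain ⟨B, _, H₁, x, ⟨e₁⟩, hx, _⟩ := frucht Γ₁
  have := VdW.finite' (A := A) (B := B) (L := A)
  obtain ⟨f₀⟩ := VdW.aut0 H₀ H₁ x h3 hx
  obtain ⟨f₁⟩ := VdW.aut1 H₀ H₁ x y h3 hx hy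
  exact ⟨VdW A B A, Fintype.ofFinite _, VdW.graph H₀ H₁ x id, VdW.leaf y, ⟨f₀.trans e₀⟩,
    ⟨((autConj (VdW.delIso H₀ H₁ x y)).trans f₁).trans e₁⟩⟩
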